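/- arXiv:2101.05531 — 8 statements merged into one kernel-verified Lean document; each statement's English description precedes it below -/
import Mathlib

section
/- Let v be a unit of the ring of integers 𝓞_L of L (i.e. v ∈ 𝓞_L and v⁻¹ ∈ 𝓞_L). Then v·σ(v) = 1 if and only if v is a torsion element of the multiplicative group Lˣ, i.e. vⁿ = 1 for some positive integer n. -/
/-- An automorphism inducing complex conjugation under an embedding `φ` satisfies
`x * σ x = 1` exactly when `φ x` lies on the unit circle. -/
theorem mul_conj_eq_one_iff_norm_eq_one {L : Type*} [Field L] (σ : L → L) (φ : L →+* ℂ)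
    (x : L) (hσ : φ (σ x) = (starRingEnd ℂ) (φ x)) : x * σ x = 1 ↔ ‖φ x‖ = 1 := by
  rw [← φ.injective.eq_iff, map_mul, hσ, map_one, Complex.mul_conj']
  norm_cast
  exact pow_eq_one_iff_of_nonneg (norm_nonneg _) two_ne_zero

/-- Let `L` be a number field with a `ℚ`-algebra automorphism `σ` acting as
complex conjugation under every complex embedding.  If `v` is a unit of the ring of integers
of `L` (i.e. both `v` and `v⁻¹` are integral over `ℤ`), then `v * σ v = 1` if and only if
`v` is a torsion element of `Lˣ`, i.e. `v ^ n = 1` for some positive integer `n`. -/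
theorem unit_norm_one_iff_torsion {L : Type*} [Field L] [NumberField L]
    (σ : L ≃ₐ[ℚ] L)
    (hσ : ∀ (φ : L →+* ℂ) (x : L), φ (σ x) = (starRingEnd ℂ) (φ x))
    (v : L) (hv : IsIntegral ℤ v) (hv' : IsIntegral ℤ v⁻¹) :
    v * σ v = 1 ↔ ∃ n : ℕ, 0 < n ∧ v ^ n = 1 := by
  constructor
  · intro h
    obtain ⟨n, hn, hvn⟩ := NumberField.Embeddings.pow_eq_one_of_norm_eq_one L ℂ hv
      fun φ => (mul_conj_eq_one_iff_norm_eq_one σ φ v (hσ φ v)).mp h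
    exact ⟨n, hn, hvn⟩
  · rintro ⟨n, hn, hvn⟩
    obtain ⟨φ⟩ : Nonempty (L →+* ℂ) := inferInstance
    refine (mul_conj_eq_one_iff_norm_eq_one σ φ v (hσ φ v)).mpr ?_
    exact Complex.norm_eq_one_of_pow_eq_one (by rw [← map_pow, hvn, map_one]) hn.ne'
end

section
/- Let R be an order in L and let I and J be fractional R-ideals. Assume that the trace dual J^t is an invertible fractional R-ideal, i.e. there exists a fractional R-ideal K with K·J^t = R. Then (J : I) = (I^t : J^t) = K·I^t. -/
variable {L : Type*} [CommRing L] [Algebra ℚ L]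

/-- A full lattice in `L`: a finitely generated `ℤ`-submodule containing a `ℚ`-basis of `L`
(equivalently, spanning `L` over `ℚ`). -/
def IsFullLattice (I : Submodule ℤ L) : Prop :=
  I.FG ∧ Submodule.span ℚ (I : Set L) = ⊤

/-- The trace dual lattice `I^t = {x ∈ L : Tr_{L/ℚ}(x·y) ∈ ℤ for all y ∈ I}`. -/
def traceDual (I : Submodule ℤ L) : Submodule ℤ L where
  carrier := {x | ∀ y ∈ I, ∃ n : ℤ, Algebra.trace ℚ L (x * y) = (n : ℚ)}
  zero_mem' := fun y _ => ⟨0, by simp⟩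
  add_mem' := by
    intro a b ha hb y hy
    obtain ⟨m, hm⟩ := ha y hy
    obtain ⟨n, hn⟩ := hb y hy
    exact ⟨m + n, by rw [add_mul, map_add, hm, hn]; push_cast; ring⟩
  smul_mem' := by
    intro c x hx y hy
    obtain ⟨n, hn⟩ := hx y hy
    refine ⟨c * n, ?_⟩
    rw [smul_mul_assoc, map_zsmul, hn, zsmul_eq_mul]
    push_cast
    ring

/-- An order in `L`: a full lattice that is also a subring of `L`. -/
def IsOrderLattice (R : Submodule ℤ L) : Prop :=
  IsFullLattice R ∧ (1 : L) ∈ R ∧ ∀ x ∈ R, ∀ y ∈ R, x * y ∈ R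

/-- A fractional `R`-ideal: a full lattice that is an `R`-submodule of `L`. -/
def IsFracIdeal (R I : Submodule ℤ L) : Prop :=
  IsFullLattice I ∧ ∀ r ∈ R, ∀ x ∈ I, r * x ∈ I

/-- The trace dual is the dual submodule with respect to the trace form. -/
theorem traceDual_eq_dualSubmodule (I : Submodule ℤ L) :
    traceDual I = (Algebra.traceForm ℚ L).dualSubmodule I := by
  ext x
  refine forall₂_congr fun y _ => ?_
  simp [Submodule.mem_one, Algebra.traceForm_apply, eq_comm]

/-- A full lattice is the `ℤ`-span of a finite `ℚ`-basis of `L`. -/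
theorem IsFullLattice.exists_basis {I : Submodule ℤ L} (hI : IsFullLattice I) :
    ∃ (n : ℕ) (b : Module.Basis (Fin n) ℚ L), Submodule.span ℤ (Set.range b) = I := by
  have : Submodule.IsLattice ℚ I := ⟨hI.1, hI.2⟩
  have b := Module.finBasis ℤ I
  refine ⟨_, b.extendOfIsLattice ℚ, ?_⟩
  have hb : ⇑(b.extendOfIsLattice ℚ) = I.subtype ∘ b :=
    funext (b.extendOfIsLattice_apply ℚ)
  rw [hb, Set.range_comp, Submodule.span_image, b.span_eq, Submodule.map_top,
    Submodule.range_subtype]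

/-- Trace duality is an involution on full lattices. -/
theorem traceDual_traceDual
    (hnd : ∀ x : L, (∀ y : L, Algebra.trace ℚ L (x * y) = 0) → x = 0)
    {I : Submodule ℤ L} (hI : IsFullLattice I) : traceDual (traceDual I) = I := by
  obtain ⟨n, b, rfl⟩ := hI.exists_basis
  have hsymm : (Algebra.traceForm ℚ L).IsSymm := Algebra.traceForm_isSymm ℚ
  have hB : (Algebra.traceForm ℚ L).Nondegenerate :=
    hsymm.isRefl.nondegenerate_iff_separatingLeft.mpr hnd
  rw [traceDual_eq_dualSubmodule, traceDual_eq_dualSubmodule]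
  exact LinearMap.BilinForm.dualSubmodule_dualSubmodule_of_basis _ hB hsymm b

/-- Passing to trace duals reverses colon lattices. -/
theorem div_le_traceDual_div_traceDual (I J : Submodule ℤ L) :
    J / I ≤ traceDual I / traceDual J := by
  intro x hx
  rw [Submodule.mem_div_iff_forall_mul_mem] at hx ⊢
  intro y hy z hz
  obtain ⟨n, hn⟩ := hy _ (hx z hz)
  exact ⟨n, by rw [← hn]; ring_nf⟩

/-- The trace dual of a module over `R` is a module over `R`. -/
theorem mul_traceDual_le {R I : Submodule ℤ L} (h : ∀ r ∈ R, ∀ x ∈ I, r * x ∈ I) :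
    R * traceDual I ≤ traceDual I := by
  rw [Submodule.mul_le]
  intro r hr x hx y hy
  obtain ⟨n, hn⟩ := hx _ (h r hr y hy)
  exact ⟨n, by rw [← hn]; ring_nf⟩

/-- Dividing by `A` is multiplying by `K` when `K * A` contains `1` and stabilizes `M`. -/
theorem div_eq_mul_of_mul_le {S : Type*} [CommRing S] {A K M : Submodule ℤ S}
    (hone : (1 : S) ∈ K * A)
    (hM : K * A * M ≤ M) : M / A = K * M := by
  apply le_antisymm
  · calc M / A ≤ K * A * (M / A) := by
          intro x hx
          simpa using Submodule.mul_mem_mul hone hx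
      _ = K * (M / A * A) := by rw [mul_assoc, mul_comm A]
      _ ≤ K * M := mul_le_mul_right (Submodule.le_div_iff_mul_le.mp le_rfl) K
  · rw [Submodule.le_div_iff_mul_le]
    calc K * M * A = K * A * M := mul_right_comm _ _ _
      _ ≤ M := hM

/-- Let `L` be an étale `ℚ`-algebra (finite-dimensional with nondegenerate
trace form), `R` an order in `L`, and `I`, `J` fractional `R`-ideals.  If the trace dual
`J^t` is invertible, i.e. there is a fractional `R`-ideal `K` with `K·J^t = R`, then
`(J : I) = (I^t : J^t) = K·I^t`.  Here `(J : I)` is written `J / I`. -/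
theorem colon_eq_traceDual_colon_eq_mul [FiniteDimensional ℚ L]
    (hnd : ∀ x : L, (∀ y : L, Algebra.trace ℚ L (x * y) = 0) → x = 0)
    (R I J K : Submodule ℤ L) (hR : IsOrderLattice R)
    (hI : IsFracIdeal R I) (hJ : IsFracIdeal R J) (hK : IsFracIdeal R K)
    (hKJt : K * traceDual J = R) :
    J / I = traceDual I / traceDual J ∧ J / I = K * traceDual I := by
  have hdiv : J / I = traceDual I / traceDual J := by
    refine le_antisymm (div_le_traceDual_div_traceDual I J) ?_
    have h := div_le_traceDual_div_traceDual (traceDual J) (traceDual I)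
    rwa [traceDual_traceDual hnd hI.1, traceDual_traceDual hnd hJ.1] at h
  refine ⟨hdiv, hdiv.trans (div_eq_mul_of_mul_le ?_ ?_)⟩
  · exact hKJt ▸ hR.2.1
  · exact hKJt ▸ mul_traceDual_le hI.2
end

section
/- Let I and J be full lattices in L such that (J : I)·I = J. Then ((J : I) : (J : I)) = (J : J). -/
variable {L : Type*} [CommRing L] [Algebra ℚ L]

/-- Let `L` be an étale `ℚ`-algebra and `I`, `J` full lattices in `L` such
that `(J : I)·I = J`.  Then `((J : I) : (J : I)) = (J : J)`.
Here `(J : I)` is written `J / I`. -/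
theorem colon_multiplicator_eq [FiniteDimensional ℚ L]
    (hnd : ∀ x : L, (∀ y : L, Algebra.trace ℚ L (x * y) = 0) → x = 0)
    (I J : Submodule ℤ L) (hI : IsFullLattice I) (hJ : IsFullLattice J)
    (hJI : (J / I) * I = J) :
    (J / I) / (J / I) = J / J := by
  apply le_antisymm
  · rw [Submodule.le_div_iff_mul_le]
    calc (J / I) / (J / I) * J = (J / I) / (J / I) * (J / I) * I := by rw [mul_assoc, hJI]
      _ ≤ (J / I) * I := mul_le_mul_left (Submodule.le_div_iff_mul_le.mp le_rfl) I
      _ = J := hJI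
  · rw [Submodule.le_div_iff_mul_le, Submodule.le_div_iff_mul_le, mul_assoc, hJI]
    exact Submodule.le_div_iff_mul_le.mp le_rfl
end

section
/- Let b ∈ L be nonzero and totally imaginary. Then for every ring homomorphism φ : L →+* ℂ the value φ(b) is purely imaginary and nonzero, and exactly one of φ and conj ∘ φ belongs to Φ_b; consequently, if [L : ℚ] = 2g then Φ_b has exactly g elements. -/
variable {L : Type*} [Field L] [NumberField L]

/-- `x ∈ L` is totally real w.r.t. the CM involution `σ`. -/
def TotallyReal (σ : L ≃ₐ[ℚ] L) (x : L) : Prop := σ x = x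

/-- `x ∈ L` is totally imaginary w.r.t. the CM involution `σ`. -/
def TotallyImaginary (σ : L ≃ₐ[ℚ] L) (x : L) : Prop := σ x = -x

/-- `x ∈ L` is totally positive: totally real and every complex embedding sends it to a
positive real number. -/
def TotallyPositive (σ : L ≃ₐ[ℚ] L) (x : L) : Prop :=
  σ x = x ∧ ∀ φ : L →+* ℂ, (φ x).im = 0 ∧ 0 < (φ x).re

/-- The CM-type `Φ_b` attached to a (nonzero totally imaginary) element `b ∈ L`:
the set of complex embeddings `φ` with `Im (φ b) > 0`. -/
def CMType (b : L) : Set (L →+* ℂ) := {φ | 0 < (φ b).im}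

/-- `x ∈ L` is `Φ_b`-positive: `Im (φ x) > 0` for every `φ ∈ Φ_b`. -/
def PhiPositive (b x : L) : Prop := ∀ φ ∈ CMType b, 0 < (φ x).im

theorem cmtype_re_eq_zero_and_ne_zero (σ : L ≃ₐ[ℚ] L)
    (hσ : ∀ (φ : L →+* ℂ) (x : L), φ (σ x) = (starRingEnd ℂ) (φ x))
    {b : L} (hb0 : b ≠ 0) (hb : TotallyImaginary σ b) (φ : L →+* ℂ) :
    (φ b).re = 0 ∧ (φ b).im ≠ 0 := by
  have h := hσ φ b
  rw [show σ b = -b from hb, map_neg] at h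
  have hre : (φ b).re = 0 := by
    have := congrArg Complex.re h
    simp only [Complex.neg_re, Complex.conj_re] at this
    linarith
  exact ⟨hre, fun him => (map_ne_zero φ).2 hb0 (Complex.ext hre him)⟩

theorem ncard_cmtype {b : L} (him : ∀ φ : L →+* ℂ, (φ b).im ≠ 0) :
    2 * (CMType b).ncard = Module.finrank ℚ L := by
  have hinv : Function.Involutive fun φ : L →+* ℂ => (starRingEnd ℂ).comp φ := fun φ => by
    ext x
    simp
  have himage : (fun φ : L →+* ℂ => (starRingEnd ℂ).comp φ) '' CMType b = (CMType b)ᶜ := by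
    rw [hinv.image_eq_preimage_symm]
    ext φ
    have := him φ
    simp only [CMType, Set.mem_preimage, Set.mem_ofPred_eq, Set.mem_compl_iff,
      RingHom.comp_apply, Complex.conj_im, Left.neg_pos_iff, not_lt]
    exact ⟨le_of_lt, fun h => lt_of_le_of_ne h this⟩
  have hcard := Set.ncard_add_ncard_compl (CMType b)
  rw [← himage, Set.ncard_image_of_injective _ hinv.injective, Nat.card_eq_fintype_card,
    NumberField.Embeddings.card] at hcard
  omega

/-- Let `b ∈ L` be nonzero and totally imaginary.  Then for every complex
embedding `φ` of `L` the value `φ b` is purely imaginary and nonzero, and exactly one of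
`φ` and `conj ∘ φ` belongs to `Φ_b`; consequently, if `[L : ℚ] = 2g` then `Φ_b` has
exactly `g` elements. -/
theorem cmtype_of_totally_imaginary (σ : L ≃ₐ[ℚ] L)
    (hσ : ∀ (φ : L →+* ℂ) (x : L), φ (σ x) = (starRingEnd ℂ) (φ x))
    (b : L) (hb0 : b ≠ 0) (hb : TotallyImaginary σ b) :
    (∀ φ : L →+* ℂ, (φ b).re = 0 ∧ φ b ≠ 0 ∧
      Xor' (φ ∈ CMType b) ((starRingEnd ℂ).comp φ ∈ CMType b)) ∧
    ∀ g : ℕ, Module.finrank ℚ L = 2 * g → (CMType b).ncard = g := by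
  have him := cmtype_re_eq_zero_and_ne_zero σ hσ hb0 hb
  refine ⟨fun φ => ⟨(him φ).1, (map_ne_zero φ).2 hb0, ?_⟩, fun g hg => ?_⟩
  · simp only [CMType, Set.mem_ofPred_eq, RingHom.comp_apply, Complex.conj_im, Left.neg_pos_iff]
    rcases lt_or_gt_of_ne (him φ).2 with h | h
    · exact Or.inr ⟨h, h.not_gt⟩
    · exact Or.inl ⟨h, h.not_gt⟩
  · have := ncard_cmtype fun φ => (him φ).2
    omega
end

section
/- Let Φ be a set of ring homomorphisms L →+* ℂ such that for every ring homomorphism ψ : L →+* ℂ exactly one of ψ and conj ∘ ψ belongs to Φ. Then there exists a nonzero totally imaginary element b ∈ L such that Φ = Φ_b, i.e. Φ = {φ : L →+* ℂ : Im(φ(b)) > 0}. -/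
variable {L : Type*} [Field L] [NumberField L]

open NumberField in
/-- Weak approximation at the infinite places, for targets in `{1, -1}`: every prescription of
signs is realised by the real parts of an element of the field. -/
theorem exists_re_embedding_sign (s : InfinitePlace L → Prop) :
    ∃ a : L, ∀ v : InfinitePlace L,
      (s v → 0 < (v.embedding a).re) ∧ (¬ s v → (v.embedding a).re < 0) := by
  classical
  obtain ⟨a, ha⟩ := Metric.denseRange_iff.mp (InfinitePlace.denseRange_algebraMap_pi L)
    (fun v => WithAbs.toAbs v.1 (if s v then 1 else -1)) 1 one_pos
  refine ⟨a, fun v => ?_⟩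
  have hv := (dist_pi_lt_iff one_pos).mp ha v
  have h : ‖v.embedding ((if s v then 1 else -1) - a)‖ < 1 := by
    rw [InfinitePlace.norm_embedding_eq]
    rw [dist_eq_norm] at hv
    exact hv
  have hre := abs_lt.mp ((Complex.abs_re_le_norm _).trans_lt h)
  constructor <;> intro hs <;> simp [hs] at hre <;> linarith

/-- Let `Φ` be a set of complex embeddings of `L` such that for every
embedding `ψ` exactly one of `ψ` and `conj ∘ ψ` belongs to `Φ`.  Then there is a nonzero
totally imaginary `b ∈ L` with `Φ = Φ_b = {φ : Im (φ b) > 0}`. -/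
theorem cmtype_eq_of_xor (σ : L ≃ₐ[ℚ] L)
    (hσ : ∀ (φ : L →+* ℂ) (x : L), φ (σ x) = (starRingEnd ℂ) (φ x))
    (Φ : Set (L →+* ℂ))
    (hΦ : ∀ ψ : L →+* ℂ, Xor' (ψ ∈ Φ) ((starRingEnd ℂ).comp ψ ∈ Φ)) :
    ∃ b : L, b ≠ 0 ∧ TotallyImaginary σ b ∧ Φ = CMType b := by
  obtain ⟨φ₀⟩ : Nonempty (L →+* ℂ) := inferInstance
  have hσσ (x : L) : σ (σ x) = x := φ₀.injective (by simp [hσ])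
  obtain ⟨x, hx⟩ : ∃ x, σ x ≠ x := by
    by_contra! h
    have hconj : (starRingEnd ℂ).comp φ₀ = φ₀ := by
      ext x
      simp [← hσ, h]
    exact (xor_iff_not_iff _ _).mp (hΦ φ₀) (by rw [hconj])
  set d := x - σ x with hd
  have hd0 : d ≠ 0 := sub_ne_zero.mpr hx.symm
  have hσd : σ d = -d := by simp [hd, hσσ]
  have hre (φ : L →+* ℂ) : (φ d).re = 0 := by
    have := congrArg Complex.re (hσ φ d)
    simp only [hσd, map_neg, Complex.neg_re, Complex.conj_re] at this
    linarith
  have him (φ : L →+* ℂ) : (φ d).im ≠ 0 := fun h =>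
    hd0 (φ.injective (by rw [map_zero]; exact Complex.ext (hre φ) h))
  obtain ⟨a, ha⟩ := exists_re_embedding_sign (L := L)
    fun v => (v.embedding ∈ Φ ↔ 0 < (v.embedding d).im)
  have key (φ : L →+* ℂ) : ((φ ∈ Φ ↔ 0 < (φ d).im) → 0 < (φ a).re) ∧
      (¬ (φ ∈ Φ ↔ 0 < (φ d).im) → (φ a).re < 0) := by
    have h := ha (NumberField.InfinitePlace.mk φ)
    rcases NumberField.InfinitePlace.embedding_mk_eq φ with h' | h'
    · rwa [h'] at h
    · have e (y : L) : NumberField.ComplexEmbedding.conjugate φ y = (starRingEnd ℂ) (φ y) := rfl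
      have hmem : NumberField.ComplexEmbedding.conjugate φ ∈ Φ ↔ φ ∉ Φ := by
        have hxor : ¬ (φ ∈ Φ ↔ NumberField.ComplexEmbedding.conjugate φ ∈ Φ) :=
          (xor_iff_not_iff _ _).mp (hΦ φ)
        tauto
      have hlt : 0 < -(φ d).im ↔ ¬ 0 < (φ d).im := by
        rw [neg_pos, not_lt, lt_iff_le_and_ne]
        exact and_iff_left (him φ)
      rw [h', e, e, hmem, Complex.conj_re, Complex.conj_im, hlt, not_iff_not] at h
      exact h
  have hb (φ : L →+* ℂ) : (φ (d * (a + σ a))).im = 2 * ((φ d).im * (φ a).re) := by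
    simp only [map_mul, map_add, hσ, Complex.mul_im, Complex.add_re, Complex.add_im,
      Complex.conj_re, Complex.conj_im, hre]
    ring
  refine ⟨d * (a + σ a), fun h => ?_, ?_, ?_⟩
  · have h0 := hb φ₀
    rw [h, map_zero, Complex.zero_im] at h0
    have ha0 : (φ₀ a).re ≠ 0 := by
      by_cases hs : φ₀ ∈ Φ ↔ 0 < (φ₀ d).im
      · exact ((key φ₀).1 hs).ne'
      · exact ((key φ₀).2 hs).ne
    exact mul_ne_zero two_ne_zero (mul_ne_zero (him φ₀) ha0) h0.symm
  · simp only [TotallyImaginary, map_mul, map_add, hσd, hσσ]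
    ring
  · ext φ
    simp only [CMType, Set.mem_ofPred_eq, hb, mul_pos_iff_of_pos_left (two_pos (α := ℝ))]
    by_cases hs : φ ∈ Φ ↔ 0 < (φ d).im
    · rw [mul_pos_iff_of_pos_right ((key φ).1 hs), hs]
    · have hneg := (key φ).2 hs
      rw [mul_pos_iff]
      have := him φ
      grind
end

section
/- Let b and b' be nonzero totally imaginary elements of L. Then Φ_b = Φ_{b'} if and only if b'/b is totally positive. -/
variable {L : Type*} [Field L] [NumberField L]

/-- Complex embeddings send totally imaginary elements to purely imaginary numbers. -/
theorem TotallyImaginary.re_eq_zero {σ : L ≃ₐ[ℚ] L}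
    (hσ : ∀ (φ : L →+* ℂ) (x : L), φ (σ x) = (starRingEnd ℂ) (φ x))
    {x : L} (hx : TotallyImaginary σ x) (φ : L →+* ℂ) : (φ x).re = 0 := by
  have h := hσ φ x
  rw [hx, map_neg] at h
  have h' := congrArg Complex.re h
  simp only [Complex.neg_re, Complex.conj_re] at h'
  linarith

/-- A complex embedding sends a quotient of totally imaginary elements to the quotient of
their imaginary parts. -/
theorem TotallyImaginary.map_div_eq {σ : L ≃ₐ[ℚ] L}
    (hσ : ∀ (φ : L →+* ℂ) (x : L), φ (σ x) = (starRingEnd ℂ) (φ x))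
    {x y : L} (hx : TotallyImaginary σ x) (hy : TotallyImaginary σ y) (φ : L →+* ℂ) :
    φ (y / x) = (((φ y).im / (φ x).im : ℝ) : ℂ) := by
  have key : ∀ z : L, TotallyImaginary σ z → φ z = ((φ z).im : ℂ) * Complex.I := fun z hz ↦ by
    apply Complex.ext <;> simp [hz.re_eq_zero hσ φ]
  rw [map_div₀, key x hx, key y hy, mul_div_mul_right _ _ Complex.I_ne_zero]
  simp

/-- Complex embeddings send nonzero totally imaginary elements to numbers with nonzero
imaginary part. -/
theorem TotallyImaginary.im_ne_zero {σ : L ≃ₐ[ℚ] L}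
    (hσ : ∀ (φ : L →+* ℂ) (x : L), φ (σ x) = (starRingEnd ℂ) (φ x))
    {x : L} (hx : TotallyImaginary σ x) (hx0 : x ≠ 0) (φ : L →+* ℂ) : (φ x).im ≠ 0 := fun h ↦
  hx0 ((map_eq_zero φ).mp (Complex.ext (hx.re_eq_zero hσ φ) h))

/-- Let `b` and `b'` be nonzero totally imaginary elements of `L`.
Then `Φ_b = Φ_{b'}` if and only if `b'/b` is totally positive. -/
theorem cmtype_eq_iff_totallyPositive (σ : L ≃ₐ[ℚ] L)
    (hσ : ∀ (φ : L →+* ℂ) (x : L), φ (σ x) = (starRingEnd ℂ) (φ x))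
    (b b' : L) (hb0 : b ≠ 0) (hb : TotallyImaginary σ b)
    (hb0' : b' ≠ 0) (hb' : TotallyImaginary σ b') :
    CMType b = CMType b' ↔ TotallyPositive σ (b' / b) := by
  have hmem : ∀ (x : L) (φ : L →+* ℂ), φ ∈ CMType x ↔ 0 < (φ x).im := fun _ _ ↦ Iff.rfl
  constructor
  · intro h
    refine ⟨by rw [map_div₀, hb, hb', neg_div_neg_eq], fun φ ↦ ?_⟩
    rw [hb.map_div_eq hσ hb' φ, Complex.ofReal_im, Complex.ofReal_re]
    refine ⟨rfl, ?_⟩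
    have h₁ : 0 < (φ b).im ↔ 0 < (φ b').im := by rw [← hmem, ← hmem, h]
    have h₂ : (φ b).im < 0 ↔ (φ b').im < 0 := by
      have hc : (starRingEnd ℂ).comp φ ∈ CMType b ↔ (starRingEnd ℂ).comp φ ∈ CMType b' := by
        rw [h]
      simpa [hmem] using hc
    rcases (hb.im_ne_zero hσ hb0 φ).lt_or_gt with hs | hs
    · exact div_pos_of_neg_of_neg (h₂.mp hs) hs
    · exact div_pos (h₁.mp hs) hs
  · rintro ⟨-, h⟩
    ext φ
    have hpos := (h φ).2
    rw [hb.map_div_eq hσ hb' φ, Complex.ofReal_re] at hpos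
    rw [hmem, hmem]
    exact ⟨fun hs ↦ (div_pos_iff_of_pos_right hs).mp hpos,
      fun ht ↦ (div_pos_iff_of_pos_left ht).mp hpos⟩
end

section
/- Let S and T be orders in L with σ(T) = T, let 𝒯 ⊆ Tˣ be a transversal of Tˣ modulo H, let i₀ ∈ L be nonzero, and let b ∈ L be nonzero totally imaginary. Let c ∈ L be totally real and a unit of both S and T. Then there is a bijection between P_1(Φ_b) and P_1(Φ_{c·b}). -/
variable {L : Type*} [Field L] [NumberField L]

/-- A unit of an order (subring) `T` of `L`: an element of `T` with an inverse in `T`. -/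
def IsUnitOfOrder (T : Subring L) (u : L) : Prop := u ∈ T ∧ ∃ v ∈ T, u * v = 1

/-- An order in `L`: a subring which is finitely generated as a `ℤ`-module and contains a
`ℚ`-basis of `L` (i.e. spans `L` over `ℚ`). -/
def IsOrder (T : Subring L) : Prop :=
  (Submodule.span ℤ (T : Set L)).FG ∧ Submodule.span ℚ (T : Set L) = ⊤

/-- `𝒯` is a transversal of `Tˣ` modulo the subgroup `H` generated by
`{v·σ(v) : v ∈ Tˣ}` (when `σ(T) = T` this generating set is itself a subgroup, since it is
closed under products and inverses, so `H = {v·σ(v) : v ∈ Tˣ}`): every unit of `T` is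
congruent modulo `H` to exactly one element of `𝒯`. -/
def IsTransversal (σ : L ≃ₐ[ℚ] L) (T : Subring L) (𝒯 : Set L) : Prop :=
  (∀ u ∈ 𝒯, IsUnitOfOrder T u) ∧
  ∀ u : L, IsUnitOfOrder T u →
    ∃! t : L, t ∈ 𝒯 ∧ ∃ v : L, IsUnitOfOrder T v ∧ u = t * (v * σ v)

/-- The set `P_α(Φ_b) = {i₀·u : u ∈ 𝒯 such that α⁻¹·i₀·u is totally imaginary and
Φ_b-positive}`; the set `P_1(Φ_b)` is the special case `α = 1`. -/
def Pset (σ : L ≃ₐ[ℚ] L) (𝒯 : Set L) (i₀ α b : L) : Set L :=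
  {x | ∃ u ∈ 𝒯, x = i₀ * u ∧ TotallyImaginary σ (α⁻¹ * (i₀ * u)) ∧
    PhiPositive b (α⁻¹ * (i₀ * u))}

section UnitOfOrder

variable {T : Subring L} {u v : L}

theorem IsUnitOfOrder.ne_zero (hu : IsUnitOfOrder T u) : u ≠ 0 := by
  obtain ⟨-, w, -, h⟩ := hu
  exact left_ne_zero_of_mul_eq_one h

theorem IsUnitOfOrder.mul (hu : IsUnitOfOrder T u) (hv : IsUnitOfOrder T v) :
    IsUnitOfOrder T (u * v) := by
  obtain ⟨hu, u', hu', h⟩ := hu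
  obtain ⟨hv, v', hv', h'⟩ := hv
  exact ⟨T.mul_mem hu hv, u' * v', T.mul_mem hu' hv', by rw [mul_mul_mul_comm, h, h', one_mul]⟩

theorem IsUnitOfOrder.inv (hu : IsUnitOfOrder T u) : IsUnitOfOrder T u⁻¹ := by
  obtain ⟨hu, u', hu', h⟩ := hu
  rw [inv_eq_of_mul_eq_one_right h]
  exact ⟨hu', u, hu, by rw [mul_comm, h]⟩

end UnitOfOrder

/-- Two elements of a transversal that are congruent modulo relative norms of units are equal. -/
theorem IsTransversal.eq_of_eq_mul {σ : L ≃ₐ[ℚ] L} {T : Subring L} {𝒯 : Set L}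
    (h𝒯 : IsTransversal σ T 𝒯) {u u' v : L} (hu : u ∈ 𝒯) (hu' : u' ∈ 𝒯)
    (hv : IsUnitOfOrder T v) (h : u = u' * (v * σ v)) : u = u' :=
  (h𝒯.2 u (h𝒯.1 u hu)).unique
    ⟨hu, 1, ⟨T.one_mem, 1, T.one_mem, one_mul 1⟩, by simp⟩ ⟨hu', v, hv, h⟩

/-- If `x` is totally imaginary and `Φ_b`-positive and `c` is totally real and nonzero, then
dividing `c * x` by a relative norm gives a `Φ_{c * b}`-positive element. -/
theorem PhiPositive.of_mul_eq_mul_norm {σ : L ≃ₐ[ℚ] L}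
    (hσ : ∀ (φ : L →+* ℂ) (x : L), φ (σ x) = (starRingEnd ℂ) (φ x))
    {b c x y v : L} (hc : TotallyReal σ c) (hv : v ≠ 0)
    (h : c * x = y * (v * σ v)) (hx : PhiPositive b x) : PhiPositive (c * b) y := by
  intro φ hφ
  have hcim : (φ c).im = 0 := by
    rw [← Complex.conj_eq_iff_im, ← hσ, hc]
  have hpos : 0 < Complex.normSq (φ v) := Complex.normSq_pos.2 (by simpa using hv)
  have him : (φ c).re * (φ x).im = (φ y).im * Complex.normSq (φ v) := by
    have h' := congrArg (fun z => (φ z).im) h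
    simpa [hσ, Complex.mul_conj, hcim] using h'
  have hb : 0 < (φ c).re * (φ b).im := by
    simpa [CMType, hcim] using hφ
  refine pos_of_mul_pos_left ?_ hpos.le
  rw [← him]
  rcases mul_pos_iff.1 hb with ⟨hc0, hb0⟩ | ⟨hc0, hb0⟩
  · exact mul_pos hc0 (hx φ hb0)
  · have hconj := hx (φ.comp (σ : L →+* L)) (by simpa [CMType, hσ] using hb0)
    exact mul_pos_of_neg_of_neg hc0 (by simpa [hσ] using hconj)

theorem TotallyImaginary.of_mul_eq_mul_norm {σ : L ≃ₐ[ℚ] L} (hσσ : ∀ x, σ (σ x) = x)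
    {c x y v : L} (hc : TotallyReal σ c) (hv : v ≠ 0)
    (h : c * x = y * (v * σ v)) (hx : TotallyImaginary σ x) : TotallyImaginary σ y := by
  have hn : v * σ v ≠ 0 := mul_ne_zero hv (by simpa using hv)
  have h' := congrArg σ h
  simp only [map_mul, hσσ] at h'
  rw [hc, hx] at h'
  refine mul_right_cancel₀ hn ?_
  linear_combination -h' - h

/-- Multiplication by a totally real unit `c`, followed by passing to the representative in the
transversal, embeds `P_1(Φ_b)` into `P_1(Φ_{c * b})`. -/
theorem nonempty_Pset_one_embedding_Pset_one_mul {σ : L ≃ₐ[ℚ] L}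
    (hσ : ∀ (φ : L →+* ℂ) (x : L), φ (σ x) = (starRingEnd ℂ) (φ x))
    {T : Subring L} {𝒯 : Set L} (h𝒯 : IsTransversal σ T 𝒯) {i₀ : L} (hi₀ : i₀ ≠ 0)
    (b : L) {c : L} (hc : TotallyReal σ c) (hcT : IsUnitOfOrder T c) :
    Nonempty (Pset σ 𝒯 i₀ 1 b ↪ Pset σ 𝒯 i₀ 1 (c * b)) := by
  have hσσ (x : L) : σ (σ x) = x := by
    obtain ⟨φ⟩ : Nonempty (L →+* ℂ) := inferInstance
    exact φ.injective (by simp [hσ])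
  have key (x : Pset σ 𝒯 i₀ 1 b) : ∃ y : Pset σ 𝒯 i₀ 1 (c * b), ∃ v : L,
      IsUnitOfOrder T v ∧ c * (x : L) = y * (v * σ v) := by
    obtain ⟨_, u, hu, rfl, him, hpos⟩ := x
    obtain ⟨t, ⟨ht, v, hv, h⟩, -⟩ := h𝒯.2 (c * u) (hcT.mul (h𝒯.1 u hu))
    have h' : c * (i₀ * u) = i₀ * t * (v * σ v) := by linear_combination i₀ * h
    rw [inv_one, one_mul] at him hpos
    refine ⟨⟨i₀ * t, t, ht, rfl, ?_, ?_⟩, v, hv, h'⟩ <;> rw [inv_one, one_mul]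
    · exact him.of_mul_eq_mul_norm hσσ hc hv.ne_zero h'
    · exact hpos.of_mul_eq_mul_norm hσ hc hv.ne_zero h'
  choose f v hv hf using key
  refine ⟨f, fun x x' hxx' => Subtype.ext ?_⟩
  have h := hf x
  have h' := hf x'
  rw [← hxx'] at h'
  obtain ⟨u, hu, hxu, -⟩ := x.2
  obtain ⟨u', hu', hxu', -⟩ := x'.2
  have hw := hv x'
  have hw0 : v x' ≠ 0 := hw.ne_zero
  have hσw0 : σ (v x') ≠ 0 := by simpa using hw0
  rw [hxu] at h
  rw [hxu'] at h'
  have huu' : u = u' := by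
    refine h𝒯.eq_of_eq_mul hu hu' ((hv x).mul hw.inv) (mul_left_cancel₀ hi₀ ?_)
    refine mul_left_cancel₀ hcT.ne_zero ?_
    rw [map_mul, map_inv₀, h]
    field_simp
    linear_combination -(v x * σ (v x)) * h'
  rw [hxu, hxu', huu']

/-- Lemma 5.9 / `sameoutputs`: With `S`, `T` orders in `L`, `T` stable
under `σ`, `𝒯` a transversal of `Tˣ` modulo `H`, `i₀ ∈ L` nonzero, `b ∈ L` nonzero
totally imaginary, and `c ∈ L` totally real and a unit of both `S` and `T`, there is a
bijection between `P_1(Φ_b)` and `P_1(Φ_{c·b})`. -/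
theorem Pset_one_equiv_Pset_one_mul (σ : L ≃ₐ[ℚ] L)
    (hσ : ∀ (φ : L →+* ℂ) (x : L), φ (σ x) = (starRingEnd ℂ) (φ x))
    (S T : Subring L) (hS : IsOrder S) (hT : IsOrder T)
    (hTσ : ∀ x : L, σ x ∈ T ↔ x ∈ T)
    (𝒯 : Set L) (h𝒯 : IsTransversal σ T 𝒯)
    (i₀ : L) (hi₀ : i₀ ≠ 0)
    (b : L) (hb0 : b ≠ 0) (hb : TotallyImaginary σ b)
    (c : L) (hc : TotallyReal σ c) (hcS : IsUnitOfOrder S c) (hcT : IsUnitOfOrder T c) :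
    Nonempty (Pset σ 𝒯 i₀ 1 b ≃ Pset σ 𝒯 i₀ 1 (c * b)) := by
  obtain ⟨f⟩ := nonempty_Pset_one_embedding_Pset_one_mul hσ h𝒯 hi₀ b hc hcT
  have hc' : TotallyReal σ c⁻¹ := by
    rw [TotallyReal, map_inv₀, hc]
  obtain ⟨g⟩ := nonempty_Pset_one_embedding_Pset_one_mul hσ h𝒯 hi₀ (c * b) hc' hcT.inv
  rw [inv_mul_cancel_left₀ hcT.ne_zero] at g
  exact f.antisymm g
end

section
/- Let S and T be orders in L with σ(T) = T, let 𝒯 ⊆ Tˣ be a transversal of Tˣ modulo H, let i₀ ∈ L be nonzero, let b ∈ L be nonzero totally imaginary, and let α be a totally real unit of S. Assume that for every totally real unit c of S there is a bijection between P_1(Φ_b) and P_1(Φ_{c·b}). Then for every totally real unit c of S there is a bijection between P_α(Φ_b) and P_1(Φ_{c·b}). -/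
variable {L : Type*} [Field L] [NumberField L]

theorem TotallyReal.inv {σ : L ≃ₐ[ℚ] L} {a : L} (ha : TotallyReal σ a) :
    TotallyReal σ a⁻¹ := by
  unfold TotallyReal at *
  rw [map_inv₀, ha]

theorem TotallyImaginary.mul_left {σ : L ≃ₐ[ℚ] L} {a x : L} (ha : TotallyReal σ a)
    (hx : TotallyImaginary σ x) : TotallyImaginary σ (a * x) := by
  unfold TotallyReal TotallyImaginary at *
  rw [map_mul, ha, hx, mul_neg]

/-- Multiplying both the CM-type generator and the element by the same totally real number
preserves positivity. -/
theorem PhiPositive.mul_left {σ : L ≃ₐ[ℚ] L}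
    (hσ : ∀ (φ : L →+* ℂ) (x : L), φ (σ x) = (starRingEnd ℂ) (φ x))
    {a b x : L} (ha : TotallyReal σ a) (hx : PhiPositive b x) :
    PhiPositive (a * b) (a * x) := by
  intro φ hφ
  have him : (φ a).im = 0 := Complex.conj_eq_iff_im.mp (by rw [← hσ, ha])
  simp only [CMType, Set.mem_ofPred_eq, map_mul, Complex.mul_im, him, zero_mul, add_zero] at hφ ⊢
  rcases mul_pos_iff.mp hφ with ⟨h, hb⟩ | ⟨h, hb⟩
  · exact mul_pos h (hx φ hb)
  · have hconj := hx (φ.comp (σ : L →+* L)) (by simpa [CMType, hσ] using hb)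
    exact mul_pos_of_neg_of_neg h (by simpa [hσ] using hconj)

/-- Twisting by a totally real `α` amounts to replacing `Φ_b` by `Φ_{αb}`. -/
theorem Pset_eq_Pset_one_mul {σ : L ≃ₐ[ℚ] L}
    (hσ : ∀ (φ : L →+* ℂ) (x : L), φ (σ x) = (starRingEnd ℂ) (φ x))
    (𝒯 : Set L) (i₀ : L) {α : L} (b : L) (hα : TotallyReal σ α) (hα0 : α ≠ 0) :
    Pset σ 𝒯 i₀ α b = Pset σ 𝒯 i₀ 1 (α * b) := by
  ext x
  simp only [Pset, Set.mem_ofPred_eq, inv_one, one_mul]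
  refine exists_congr fun u => and_congr_right fun _ => and_congr_right fun _ => ⟨?_, ?_⟩
  · rintro ⟨him, hpos⟩
    have him' := him.mul_left hα
    have hpos' := hpos.mul_left hσ hα
    rw [mul_inv_cancel_left₀ hα0] at him' hpos'
    exact ⟨him', hpos'⟩
  · rintro ⟨him, hpos⟩
    have hpos' := hpos.mul_left hσ hα.inv
    rw [inv_mul_cancel_left₀ hα0] at hpos'
    exact ⟨him.mul_left hα.inv, hpos'⟩

/-- Theorem 5.10, (5) ⇒ (6): With `S`, `T` orders in `L`, `T` stable
under `σ`, `𝒯` a transversal of `Tˣ` modulo `H`, `i₀ ∈ L` nonzero, `b ∈ L` nonzero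
totally imaginary, and `α` a totally real unit of `S`: if for every totally real unit
`c` of `S` there is a bijection `P_1(Φ_b) ≃ P_1(Φ_{c·b})`, then for every totally real
unit `c` of `S` there is a bijection `P_α(Φ_b) ≃ P_1(Φ_{c·b})`. -/
theorem Pset_alpha_equiv_of_Pset_one_equiv (σ : L ≃ₐ[ℚ] L)
    (hσ : ∀ (φ : L →+* ℂ) (x : L), φ (σ x) = (starRingEnd ℂ) (φ x))
    (S T : Subring L) (hS : IsOrder S) (hT : IsOrder T)
    (hTσ : ∀ x : L, σ x ∈ T ↔ x ∈ T)
    (𝒯 : Set L) (h𝒯 : IsTransversal σ T 𝒯)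
    (i₀ : L) (hi₀ : i₀ ≠ 0)
    (b : L) (hb0 : b ≠ 0) (hb : TotallyImaginary σ b)
    (α : L) (hα : TotallyReal σ α) (hαS : IsUnitOfOrder S α)
    (h5 : ∀ c : L, TotallyReal σ c → IsUnitOfOrder S c →
      Nonempty (Pset σ 𝒯 i₀ 1 b ≃ Pset σ 𝒯 i₀ 1 (c * b))) :
    ∀ c : L, TotallyReal σ c → IsUnitOfOrder S c →
      Nonempty (Pset σ 𝒯 i₀ α b ≃ Pset σ 𝒯 i₀ 1 (c * b)) := by
  have hα0 : α ≠ 0 := by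
    obtain ⟨-, v, -, hv⟩ := hαS
    exact left_ne_zero_of_mul_eq_one hv
  intro c hc hcS
  rw [Pset_eq_Pset_one_mul hσ 𝒯 i₀ b hα hα0]
  obtain ⟨e⟩ := h5 α hα hαS
  obtain ⟨f⟩ := h5 c hc hcS
  exact ⟨e.symm.trans f⟩
end
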